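/- Let p be an odd prime, k a field of characteristic p, and β ∈ k. The algebra Λ(β) = k⟨x,y,z⟩/⟨x^p, y^p, [x,y], [x,z], [y,z] − x, z^p + x^{p−1}y − βx⟩ (the algebra of type A5 for p > 2) is isomorphic as a k-algebra to k⟨y,z⟩/⟨[y,z]^p, y^p, 2yzy − zy^2 − y^2z, yz^2 + z^2y − 2zyz, z^p + (yz − zy)^{p−1}y − β(yz − zy)⟩. -/

import Mathlib

noncomputable section

/-- The ring commutator `[a,b] = ab - ba`. -/
def commutator' {A : Type*} [Ring A] (a b : A) : A := a * b - b * a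

/-- The relation on an algebra `A` identifying each element of `S` with `0`;
`RingQuot` of this relation is the quotient of `A` by the two-sided ideal
generated by `S`. -/
def relOf {A : Type*} [Ring A] (S : Set A) : A → A → Prop := fun a b => a ∈ S ∧ b = 0

/-- The quotient map of `relOf S` kills `S`. -/
theorem mkAlgHom_relOf_eq_zero {k A : Type*} [CommRing k] [Ring A] [Algebra k A] {S : Set A}
    {a : A} (ha : a ∈ S) : RingQuot.mkAlgHom k (relOf S) a = 0 := by
  simpa using RingQuot.mkAlgHom_rel k (s := relOf S) (show relOf S a 0 from ⟨ha, rfl⟩)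

/-- Two quotients are isomorphic as soon as there are maps between the ambient algebras which
respect the relations and are mutually inverse modulo the relations. -/
theorem nonempty_algEquiv_ringQuot_relOf.{u} {k : Type*} {A B : Type u} [CommRing k] [Ring A]
    [Algebra k A] [Ring B] [Algebra k B] {S : Set A} {T : Set B} (F : A →ₐ[k] B) (G : B →ₐ[k] A)
    (hF : ∀ (C : Type u) [Ring C] [Algebra k C] (q : B →ₐ[k] C), (∀ b ∈ T, q b = 0) →
      (∀ a ∈ S, q (F a) = 0) ∧ (q.comp F).comp G = q)
    (hG : ∀ (C : Type u) [Ring C] [Algebra k C] (q : A →ₐ[k] C), (∀ a ∈ S, q a = 0) →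
      (∀ b ∈ T, q (G b) = 0) ∧ (q.comp G).comp F = q) :
    Nonempty (RingQuot (relOf S) ≃ₐ[k] RingQuot (relOf T)) := by
  obtain ⟨hF, hFG⟩ := hF _ (RingQuot.mkAlgHom k (relOf T)) fun _ => mkAlgHom_relOf_eq_zero
  obtain ⟨hG, hGF⟩ := hG _ (RingQuot.mkAlgHom k (relOf S)) fun _ => mkAlgHom_relOf_eq_zero
  refine ⟨AlgEquiv.ofAlgHom
    (RingQuot.liftAlgHom k ⟨(RingQuot.mkAlgHom k (relOf T)).comp F, ?_⟩)
    (RingQuot.liftAlgHom k ⟨(RingQuot.mkAlgHom k (relOf S)).comp G, ?_⟩) ?_ ?_⟩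
  · rintro a b ⟨ha, rfl⟩
    simpa using hF a ha
  · rintro a b ⟨ha, rfl⟩
    simpa using hG a ha
  · refine RingQuot.ringQuot_ext' _ _ _ (AlgHom.ext fun b => ?_)
    simpa using DFunLike.congr_fun hFG b
  · refine RingQuot.ringQuot_ext' _ _ _ (AlgHom.ext fun a => ?_)
    simpa using DFunLike.congr_fun hGF a

/-- For `p` an odd prime and `β ∈ k`, the algebra of type A5,
`Λ(β) = k⟨x,y,z⟩/⟨x^p, y^p, [x,y], [x,z], [y,z] − x, z^p + x^{p−1}y − βx⟩`,
is isomorphic as a `k`-algebra to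
`k⟨y,z⟩/⟨[y,z]^p, y^p, 2yzy − zy² − y²z, yz² + z²y − 2zyz,
  z^p + (yz − zy)^{p−1}y − β(yz − zy)⟩`. -/
theorem stmt17 (p : ℕ) (hp : p.Prime) (hodd : Odd p) (k : Type*) [Field k] [CharP k p]
    (β : k) :
    Nonempty
      (RingQuot (relOf
          (({FreeAlgebra.ι k (0 : Fin 3) ^ p,
             FreeAlgebra.ι k (1 : Fin 3) ^ p,
             commutator' (FreeAlgebra.ι k (0 : Fin 3)) (FreeAlgebra.ι k 1),
             commutator' (FreeAlgebra.ι k (0 : Fin 3)) (FreeAlgebra.ι k 2),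
             commutator' (FreeAlgebra.ι k (1 : Fin 3)) (FreeAlgebra.ι k 2) -
               FreeAlgebra.ι k 0,
             FreeAlgebra.ι k (2 : Fin 3) ^ p +
               FreeAlgebra.ι k (0 : Fin 3) ^ (p - 1) * FreeAlgebra.ι k 1 -
               β • FreeAlgebra.ι k (0 : Fin 3)} :
            Set (FreeAlgebra k (Fin 3))))) ≃ₐ[k]
        RingQuot (relOf
          (({commutator' (FreeAlgebra.ι k (0 : Fin 2)) (FreeAlgebra.ι k 1) ^ p,
             FreeAlgebra.ι k (0 : Fin 2) ^ p,
             2 * (FreeAlgebra.ι k (0 : Fin 2) * FreeAlgebra.ι k 1 * FreeAlgebra.ι k 0) -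
               FreeAlgebra.ι k (1 : Fin 2) * FreeAlgebra.ι k 0 ^ 2 -
               FreeAlgebra.ι k (0 : Fin 2) ^ 2 * FreeAlgebra.ι k 1,
             FreeAlgebra.ι k (0 : Fin 2) * FreeAlgebra.ι k 1 ^ 2 +
               FreeAlgebra.ι k (1 : Fin 2) ^ 2 * FreeAlgebra.ι k 0 -
               2 * (FreeAlgebra.ι k (1 : Fin 2) * FreeAlgebra.ι k 0 * FreeAlgebra.ι k 1),
             FreeAlgebra.ι k (1 : Fin 2) ^ p +
               (FreeAlgebra.ι k (0 : Fin 2) * FreeAlgebra.ι k 1 -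
                 FreeAlgebra.ι k (1 : Fin 2) * FreeAlgebra.ι k 0) ^ (p - 1) *
                 FreeAlgebra.ι k 0 -
               β • (FreeAlgebra.ι k (0 : Fin 2) * FreeAlgebra.ι k 1 -
                 FreeAlgebra.ι k (1 : Fin 2) * FreeAlgebra.ι k 0)} :
            Set (FreeAlgebra k (Fin 2)))))) := by
  refine nonempty_algEquiv_ringQuot_relOf
    (FreeAlgebra.lift k ![commutator' (FreeAlgebra.ι k 0) (FreeAlgebra.ι k 1),
      FreeAlgebra.ι k 0, FreeAlgebra.ι k 1])
    (FreeAlgebra.lift k ![FreeAlgebra.ι k 1, FreeAlgebra.ι k 2]) ?_ ?_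
  · intro C _ _ q hq
    simp only [Set.forall_mem_insert, Set.mem_singleton_iff, forall_eq, commutator', map_sub,
      map_add, map_mul, map_pow, map_smul, map_ofNat, FreeAlgebra.lift_ι_apply,
      Matrix.cons_val] at hq ⊢
    obtain ⟨hx, hy, hxy, hxz, hz⟩ := hq
    refine ⟨⟨hx, hy, ?_, ?_, sub_self _, hz⟩, ?_⟩
    · rw [← hxy]
      noncomm_ring
    · rw [← hxz]
      noncomm_ring
    · ext i
      fin_cases i <;> simp
  · intro C _ _ q hq
    simp only [Set.forall_mem_insert, Set.mem_singleton_iff, forall_eq, commutator', map_sub,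
      map_add, map_mul, map_pow, map_smul, map_ofNat, FreeAlgebra.lift_ι_apply,
      Matrix.cons_val] at hq ⊢
    obtain ⟨hx, hy, hxy, hxz, hyz, hz⟩ := hq
    rw [sub_eq_zero] at hyz
    refine ⟨⟨?_, hy, ?_, ?_, ?_⟩, ?_⟩
    · rw [hyz, hx]
    · rw [← hxy, ← hyz]
      noncomm_ring
    · rw [← hxz, ← hyz]
      noncomm_ring
    · rw [hyz, hz]
    · ext i
      fin_cases i
      · simpa [commutator'] using hyz
      · simp
      · simp
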